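/- Let 𝒳 be a fuzzy random number with 𝒳 ∈ L¹ and D_1(A;𝒳) := (1 + E[ρ_1(A,𝒳)])⁻¹. Then D_1 satisfies property P3b for the metric ρ_1: if A ∈ F_c(ℝ) maximizes D_1(·;𝒳) over F_c(ℝ), then for all U, V ∈ F_c(ℝ) satisfying ρ_1(A,V) = ρ_1(A,U) + ρ_1(U,V) one has D_1(A;𝒳) ≥ D_1(U;𝒳) ≥ D_1(V;𝒳). -/

import Mathlib

open MeasureTheory Set ENNReal

noncomputable section

/-- The α-levels of a membership function `A : ℝ → [0,1]`. -/
def fuzzyLevel (A : ℝ → ℝ) (α : ℝ) : Set ℝ :=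
  if α = 0 then closure {x | 0 < A x} else {x | α ≤ A x}

/-- A fuzzy number: a function `ℝ → [0,1]` all of whose α-levels (α ∈ [0,1])
are nonempty compact convex subsets of ℝ. -/
structure FuzzyNumber where
  mem : ℝ → ℝ
  mem_range : ∀ x, mem x ∈ Set.Icc (0:ℝ) 1
  level_nonempty : ∀ α ∈ Set.Icc (0:ℝ) 1, (fuzzyLevel mem α).Nonempty
  level_compact : ∀ α ∈ Set.Icc (0:ℝ) 1, IsCompact (fuzzyLevel mem α)
  level_convex : ∀ α ∈ Set.Icc (0:ℝ) 1, Convex ℝ (fuzzyLevel mem α)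

/-- Support function of a fuzzy number. -/
def suppFn (A : FuzzyNumber) (u α : ℝ) : ℝ :=
  sSup ((fun v => u * v) '' fuzzyLevel A.mem α)

/-- Set of medians of a real random variable. -/
def MedSet {Ω : Type*} [MeasurableSpace Ω] (P : Measure Ω) (Y : Ω → ℝ) : Set ℝ :=
  {m : ℝ | 1/2 ≤ P {ω | Y ω ≤ m} ∧ 1/2 ≤ P {ω | m ≤ Y ω}}

/-- A fuzzy number is a support median of a fuzzy random number. -/
def IsSupportMedian {Ω : Type*} [MeasurableSpace Ω] (P : Measure Ω)
    (𝒳 : Ω → FuzzyNumber) (A : FuzzyNumber) : Prop :=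
  ∀ u ∈ ({-1, 1} : Set ℝ), ∀ α ∈ Set.Icc (0:ℝ) 1,
    suppFn A u α ∈ MedSet P (fun ω => suppFn (𝒳 ω) u α)

/-- Measurability of each real random variable `s_𝒳(u,α)`. -/
def SuppMeasurable {Ω : Type*} [MeasurableSpace Ω] (𝒳 : Ω → FuzzyNumber) : Prop :=
  ∀ u ∈ ({-1, 1} : Set ℝ), ∀ α ∈ Set.Icc (0:ℝ) 1,
    Measurable fun ω => suppFn (𝒳 ω) u α

/-- Joint measurability of `(u,α,ω) ↦ s_{𝒳(ω)}(u,α)` on {−1,1}×[0,1]×Ω. -/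
def JointlyMeasurable {Ω : Type*} [MeasurableSpace Ω] (𝒳 : Ω → FuzzyNumber) : Prop :=
  Measurable fun q : ({-1, 1} : Set ℝ) × (Set.Icc (0:ℝ) 1) × Ω =>
    suppFn (𝒳 q.2.2) (q.1 : ℝ) (q.2.1 : ℝ)

/-- The ρ₁ metric between fuzzy numbers. -/
def rho1 (A B : FuzzyNumber) : ℝ :=
  (1/2) * ∫ α in (0:ℝ)..1,
    (|suppFn A 1 α - suppFn B 1 α| + |suppFn A (-1) α - suppFn B (-1) α|)

/-- `𝒳 ∈ L¹`: the random variable `sup_{x ∈ 𝒳₀} |x|` is integrable. -/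
def FuzzyL1 {Ω : Type*} [MeasurableSpace Ω] (P : Measure Ω) (𝒳 : Ω → FuzzyNumber) : Prop :=
  Integrable (fun ω => sSup ((fun x => |x|) '' fuzzyLevel (𝒳 ω).mem 0)) P

/-- Fuzzy Tukey depth. -/
def DFT {Ω : Type*} [MeasurableSpace Ω] (P : Measure Ω) (𝒳 : Ω → FuzzyNumber)
    (A : FuzzyNumber) : ℝ≥0∞ :=
  ⨅ u ∈ ({-1, 1} : Set ℝ), ⨅ α ∈ Set.Icc (0:ℝ) 1,
    min (P {ω | suppFn (𝒳 ω) u α ≤ suppFn A u α})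
        (P {ω | suppFn A u α ≤ suppFn (𝒳 ω) u α})

/-- Midpoint median of a real random variable. -/
def medMid {Ω : Type*} [MeasurableSpace Ω] (P : Measure Ω) (Y : Ω → ℝ) : ℝ :=
  (sInf (MedSet P Y) + sSup (MedSet P Y)) / 2

/-- Median absolute deviation. -/
def MAD {Ω : Type*} [MeasurableSpace Ω] (P : Measure Ω) (Y : Ω → ℝ) : ℝ :=
  medMid P (fun ω => |Y ω - medMid P Y|)

/-- Outlyingness function. -/
def outly {Ω : Type*} [MeasurableSpace Ω] (P : Measure Ω) (𝒳 : Ω → FuzzyNumber)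
    (A : FuzzyNumber) : ℝ :=
  sSup {r : ℝ | ∃ u ∈ ({-1, 1} : Set ℝ), ∃ α ∈ Set.Icc (0:ℝ) 1,
    r = |suppFn A u α - medMid P (fun ω => suppFn (𝒳 ω) u α)| /
        MAD P (fun ω => suppFn (𝒳 ω) u α)}

/-- Fuzzy projection depth. -/
def DFP {Ω : Type*} [MeasurableSpace Ω] (P : Measure Ω) (𝒳 : Ω → FuzzyNumber)
    (A : FuzzyNumber) : ℝ :=
  (1 + outly P 𝒳 A)⁻¹

/-- Uniform probability on {−1,1} (as a measure on ℝ). -/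
def coinMeasure : Measure ℝ := (2:ℝ≥0∞)⁻¹ • (Measure.dirac (-1) + Measure.dirac 1)

/-- υ ⊗ ν on {−1,1} × [0,1]. -/
def baseMeasure : Measure (ℝ × ℝ) := coinMeasure.prod (volume.restrict (Set.Icc (0:ℝ) 1))

/-- Modified simplicial depth (p = 1, two independent copies). -/
def DmS {Ω : Type*} [MeasurableSpace Ω] (P : Measure Ω) (𝒳 : Ω → FuzzyNumber)
    (A : FuzzyNumber) : ℝ :=
  ∫ ω : Ω × Ω,
    (baseMeasure {p : ℝ × ℝ |
      min (suppFn (𝒳 ω.1) p.1 p.2) (suppFn (𝒳 ω.2) p.1 p.2) ≤ suppFn A p.1 p.2 ∧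
      suppFn A p.1 p.2 ≤ max (suppFn (𝒳 ω.1) p.1 p.2) (suppFn (𝒳 ω.2) p.1 p.2)}).toReal
    ∂(P.prod P)

/-- Fuzzy simplicial depth (p = 1). -/
def DFS {Ω : Type*} [MeasurableSpace Ω] (P : Measure Ω) (𝒳 : Ω → FuzzyNumber)
    (A : FuzzyNumber) : ℝ :=
  min
    (∫ ω : Ω × Ω,
      (volume {α ∈ Set.Icc (0:ℝ) 1 |
        min (suppFn (𝒳 ω.1) 1 α) (suppFn (𝒳 ω.2) 1 α) ≤ suppFn A 1 α ∧
        suppFn A 1 α ≤ max (suppFn (𝒳 ω.1) 1 α) (suppFn (𝒳 ω.2) 1 α)}).toReal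
      ∂(P.prod P))
    (∫ ω : Ω × Ω,
      (volume {α ∈ Set.Icc (0:ℝ) 1 |
        min (suppFn (𝒳 ω.1) (-1) α) (suppFn (𝒳 ω.2) (-1) α) ≤ suppFn A (-1) α ∧
        suppFn A (-1) α ≤ max (suppFn (𝒳 ω.1) (-1) α) (suppFn (𝒳 ω.2) (-1) α)}).toReal
      ∂(P.prod P))

/-- The L¹-type depth `D₁(A;𝒳) := (1 + E[ρ₁(A,𝒳)])⁻¹`. -/
def D1 {Ω : Type*} [MeasurableSpace Ω] (P : Measure Ω) (𝒳 : Ω → FuzzyNumber)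
    (A : FuzzyNumber) : ℝ :=
  (1 + ∫ ω, rho1 A (𝒳 ω) ∂P)⁻¹

section MeanDistance

variable {Ω : Type*} [MeasurableSpace Ω] {P : Measure Ω}

/-- The expected distance `E|x - Y|`. -/
def meanDist (P : Measure Ω) (Y : Ω → ℝ) (x : ℝ) : ℝ := ∫ ω, |x - Y ω| ∂P

/-- The largest minimizer of `x ↦ E|x - Y|`, that is, the largest median of `Y`. -/
def upperMedian (P : Measure Ω) (Y : Ω → ℝ) : ℝ :=
  sSup {x | ∀ z, meanDist P Y x ≤ meanDist P Y z}

lemma meanDist_neg (Y : Ω → ℝ) (x : ℝ) :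
    meanDist P (fun ω => -Y ω) (-x) = meanDist P Y x := by
  refine integral_congr_ae (.of_forall fun ω => ?_)
  simp only
  rw [← abs_neg, neg_sub_neg, neg_sub]

variable [IsProbabilityMeasure P]

lemma integrable_abs_const_sub {Y : Ω → ℝ} (hY : Integrable Y P) (x : ℝ) :
    Integrable (fun ω => |x - Y ω|) P :=
  ((integrable_const x).sub hY).abs

lemma meanDist_le_add {Y : Ω → ℝ} (hY : Integrable Y P) (x y : ℝ) :
    meanDist P Y x ≤ meanDist P Y y + |x - y| := by
  have h : ∫ ω, (|y - Y ω| + |x - y|) ∂P = meanDist P Y y + |x - y| := by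
    rw [integral_add (integrable_abs_const_sub hY y) (integrable_const _)]
    simp [meanDist]
  rw [← h]
  refine integral_mono (integrable_abs_const_sub hY x)
    ((integrable_abs_const_sub hY y).add (integrable_const _)) fun ω => ?_
  have := abs_sub_le x y (Y ω)
  simp only
  linarith

lemma continuous_meanDist {Y : Ω → ℝ} (hY : Integrable Y P) : Continuous (meanDist P Y) := by
  refine (LipschitzWith.of_le_add fun x y => ?_).continuous
  simpa [Real.dist_eq] using meanDist_le_add hY x y

lemma abs_sub_le_meanDist {Y : Ω → ℝ} (hY : Integrable Y P) (x : ℝ) :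
    |x| - meanDist P Y 0 ≤ meanDist P Y x := by
  have h : ∫ ω, (|x| - |0 - Y ω|) ∂P = |x| - meanDist P Y 0 := by
    rw [integral_sub (integrable_const _) (integrable_abs_const_sub hY 0)]
    simp [meanDist]
  rw [← h]
  refine integral_mono ((integrable_const _).sub (integrable_abs_const_sub hY 0))
    (integrable_abs_const_sub hY x) fun ω => ?_
  have := abs_sub_abs_le_abs_sub x (Y ω)
  simp only [zero_sub, abs_neg]
  linarith

lemma isGreatest_upperMedian {Y : Ω → ℝ} (hY : Integrable Y P) :
    IsGreatest {x | ∀ z, meanDist P Y x ≤ meanDist P Y z} (upperMedian P Y) := by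
  have hc := continuous_meanDist hY
  have hlim : Filter.Tendsto (meanDist P Y) (Filter.cocompact ℝ) Filter.atTop := by
    refine Filter.tendsto_atTop_mono (abs_sub_le_meanDist hY) ?_
    exact Filter.tendsto_atTop_add_const_right _ _ tendsto_norm_cocompact_atTop
  have hne : {x | ∀ z, meanDist P Y x ≤ meanDist P Y z}.Nonempty := hc.exists_forall_le hlim
  have hcl : IsClosed {x | ∀ z, meanDist P Y x ≤ meanDist P Y z} := by
    simp only [ofPred_forall]
    exact isClosed_iInter fun z => isClosed_le hc continuous_const
  have hbdd : BddAbove {x | ∀ z, meanDist P Y x ≤ meanDist P Y z} := by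
    refine ⟨2 * meanDist P Y 0, fun x hx => ?_⟩
    have h₁ := hx 0
    have h₂ := abs_sub_le_meanDist hY x
    linarith [le_abs_self x]
  exact ⟨hcl.csSup_mem hne hbdd, fun x hx => le_csSup hbdd hx⟩

lemma meanDist_upperMedian_le {Y : Ω → ℝ} (hY : Integrable Y P) (z : ℝ) :
    meanDist P Y (upperMedian P Y) ≤ meanDist P Y z :=
  (isGreatest_upperMedian hY).1 z

lemma abs_sub_add_abs_sub_le {x y s t : ℝ} (hxy : x ≤ y) (hst : s ≤ t) :
    |y - t| + |x - s| ≤ |y - s| + |x - t| := by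
  rcases abs_cases (y - t) with h₁ | h₁ <;> rcases abs_cases (x - s) with h₂ | h₂ <;>
    rcases abs_cases (y - s) with h₃ | h₃ <;> rcases abs_cases (x - t) with h₄ | h₄ <;> linarith

lemma upperMedian_mono {Y Z : Ω → ℝ} (hY : Integrable Y P) (hZ : Integrable Z P)
    (h : ∀ ω, Y ω ≤ Z ω) : upperMedian P Y ≤ upperMedian P Z := by
  by_contra! hlt
  set a := upperMedian P Z
  set b := upperMedian P Y
  have hsum : meanDist P Z b + meanDist P Y a ≤ meanDist P Y b + meanDist P Z a := by
    simp only [meanDist]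
    rw [← integral_add (integrable_abs_const_sub hZ b) (integrable_abs_const_sub hY a),
      ← integral_add (integrable_abs_const_sub hY b) (integrable_abs_const_sub hZ a)]
    exact integral_mono ((integrable_abs_const_sub hZ b).add (integrable_abs_const_sub hY a))
      ((integrable_abs_const_sub hY b).add (integrable_abs_const_sub hZ a))
      fun ω => abs_sub_add_abs_sub_le hlt.le (h ω)
  have hb : b ∈ {x | ∀ z, meanDist P Z x ≤ meanDist P Z z} := fun z => by
    have h₁ : meanDist P Y b ≤ meanDist P Y a := meanDist_upperMedian_le hY a
    have h₂ : meanDist P Z a ≤ meanDist P Z z := meanDist_upperMedian_le hZ z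
    linarith
  exact absurd ((isGreatest_upperMedian hZ).2 hb) (not_le.2 hlt)

lemma convexOn_meanDist {Y : Ω → ℝ} (hY : Integrable Y P) :
    ConvexOn ℝ univ (meanDist P Y) := by
  refine ⟨convex_univ, fun x _ y _ a b ha hb hab => ?_⟩
  simp only [meanDist, smul_eq_mul]
  rw [← integral_const_mul, ← integral_const_mul,
    ← integral_add ((integrable_abs_const_sub hY x).const_mul a)
      ((integrable_abs_const_sub hY y).const_mul b)]
  refine integral_mono (integrable_abs_const_sub hY _)
    (((integrable_abs_const_sub hY x).const_mul a).add
      ((integrable_abs_const_sub hY y).const_mul b)) fun ω => ?_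
  have : a * x + b * y - Y ω = a * (x - Y ω) + b * (y - Y ω) := by
    linear_combination Y ω * hab
  simp only [this]
  refine (abs_add_le _ _).trans_eq ?_
  rw [abs_mul, abs_mul, abs_of_nonneg ha, abs_of_nonneg hb]

lemma meanDist_le_of_wbtw {Y : Ω → ℝ} (hY : Integrable Y P) {a u v : ℝ}
    (ha : ∀ z, meanDist P Y a ≤ meanDist P Y z) (h : Wbtw ℝ a u v) :
    meanDist P Y u ≤ meanDist P Y v := by
  have := (convexOn_meanDist hY).le_on_segment (mem_univ a) (mem_univ v)
    (mem_segment_iff_wbtw.2 h)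
  rwa [max_eq_right (ha v)] at this

end MeanDistance

section SupportFunction

lemma fuzzyLevel_anti (A : FuzzyNumber) {α β : ℝ} (hα : 0 ≤ α) (h : α ≤ β) :
    fuzzyLevel A.mem β ⊆ fuzzyLevel A.mem α := by
  unfold fuzzyLevel
  split_ifs with hβ hα' hα'
  · exact subset_rfl
  · exact absurd (le_antisymm (hβ ▸ h) hα) hα'
  · exact fun x hx => subset_closure (lt_of_lt_of_le (lt_of_le_of_ne (hα.trans h) (Ne.symm hβ)) hx)
  · exact fun x hx => h.trans hx

lemma bddAbove_mul_level (A : FuzzyNumber) (u : ℝ) {α : ℝ} (hα : α ∈ Icc (0 : ℝ) 1) :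
    BddAbove ((fun v => u * v) '' fuzzyLevel A.mem α) :=
  ((A.level_compact α hα).image (continuous_const_mul u)).bddAbove

lemma mul_le_suppFn (A : FuzzyNumber) (u : ℝ) {α v : ℝ} (hα : α ∈ Icc (0 : ℝ) 1)
    (hv : v ∈ fuzzyLevel A.mem α) : u * v ≤ suppFn A u α :=
  le_csSup (bddAbove_mul_level A u hα) (mem_image_of_mem _ hv)

lemma antitone_suppFn (A : FuzzyNumber) (u : ℝ) :
    Antitone fun α : unitInterval => suppFn A u α := fun α β h =>
  csSup_le_csSup (bddAbove_mul_level A u α.2) ((A.level_nonempty β β.2).image _)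
    (image_mono (fuzzyLevel_anti A α.2.1 h))

lemma measurable_suppFn (A : FuzzyNumber) (u : ℝ) :
    Measurable fun α : unitInterval => suppFn A u α :=
  (antitone_suppFn A u).measurable

lemma neg_suppFn_neg_one_le (A : FuzzyNumber) {α : ℝ} (hα : α ∈ Icc (0 : ℝ) 1) :
    -suppFn A (-1) α ≤ suppFn A 1 α := by
  obtain ⟨v, hv⟩ := A.level_nonempty α hα
  have h₁ := mul_le_suppFn A 1 hα hv
  have h₂ := mul_le_suppFn A (-1) hα hv
  linarith

lemma abs_suppFn_le (A : FuzzyNumber) {u α : ℝ} (hu : u ∈ ({-1, 1} : Set ℝ))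
    (hα : α ∈ Icc (0 : ℝ) 1) :
    |suppFn A u α| ≤ sSup ((fun x => |x|) '' fuzzyLevel A.mem 0) := by
  obtain ⟨v, hv, hvs⟩ := ((A.level_compact α hα).image (continuous_const_mul u)).sSup_mem
    ((A.level_nonempty α hα).image _)
  have habs : |suppFn A u α| = |v| := by
    rw [suppFn, ← hvs, abs_mul]
    rcases hu with rfl | rfl <;> simp
  rw [habs]
  exact le_csSup ((A.level_compact 0 ⟨le_rfl, zero_le_one⟩).image continuous_abs).bddAbove
    (mem_image_of_mem _ (fuzzyLevel_anti A le_rfl hα.1 hv))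

lemma rho1_eq_integral (A B : FuzzyNumber) :
    rho1 A B = (1 / 2) * ∫ α : unitInterval,
      (|suppFn A 1 α - suppFn B 1 α| + |suppFn A (-1) α - suppFn B (-1) α|) := by
  rw [rho1, intervalIntegral.integral_of_le zero_le_one, ← integral_Icc_eq_integral_Ioc,
    ← integral_subtype_comap measurableSet_Icc]
  rfl

lemma integrable_abs_suppFn_sub (A B : FuzzyNumber) {u : ℝ} (hu : u ∈ ({-1, 1} : Set ℝ)) :
    Integrable fun α : unitInterval => |suppFn A u α - suppFn B u α| := by
  have h (C : FuzzyNumber) : Integrable fun α : unitInterval => suppFn C u α :=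
    .of_bound (measurable_suppFn C u).aestronglyMeasurable _
      (.of_forall fun α => abs_suppFn_le C hu α.2)
  exact ((h A).sub (h B)).abs

/-- Equality in the triangle inequality for `ρ₁` forces the support functions to be ordered. -/
lemma ae_wbtw_of_rho1_eq {A U V : FuzzyNumber} (h : rho1 A V = rho1 A U + rho1 U V) :
    ∀ᵐ α : unitInterval, ∀ u ∈ ({-1, 1} : Set ℝ),
      Wbtw ℝ (suppFn A u α) (suppFn U u α) (suppFn V u α) := by
  have hint (B C : FuzzyNumber) : Integrable fun α : unitInterval =>
      (|suppFn B 1 α - suppFn C 1 α| + |suppFn B (-1) α - suppFn C (-1) α|) :=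
    (integrable_abs_suppFn_sub B C (by simp)).add (integrable_abs_suppFn_sub B C (by simp))
  simp only [rho1_eq_integral] at h
  have hzero := integral_sub ((hint A U).add (hint U V)) (hint A V)
  have hadd := integral_add (hint A U) (hint U V)
  simp only [Pi.add_apply] at hzero
  rw [hadd, show ∀ a b c : ℝ, a + b - c = 2 * ((1 / 2 * a + 1 / 2 * b) - 1 / 2 * c) by
    intros; ring, ← h, sub_self, mul_zero, integral_eq_zero_iff_of_nonneg] at hzero
  · filter_upwards [hzero] with α hα u hu
    have t₁ := abs_sub_le (suppFn A 1 α) (suppFn U 1 α) (suppFn V 1 α)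
    have t₂ := abs_sub_le (suppFn A (-1) α) (suppFn U (-1) α) (suppFn V (-1) α)
    simp only [Pi.zero_apply] at hα
    rw [← dist_add_dist_eq_iff]
    simp only [Real.dist_eq]
    rcases hu with rfl | rfl <;> linarith
  · intro α
    have t₁ := abs_sub_le (suppFn A 1 α) (suppFn U 1 α) (suppFn V 1 α)
    have t₂ := abs_sub_le (suppFn A (-1) α) (suppFn U (-1) α) (suppFn V (-1) α)
    simp only [Pi.zero_apply]
    linarith
  · exact ((hint A U).add (hint U V)).sub (hint A V)

end SupportFunction

section OfEndpoints

variable {L R : ℝ → ℝ}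

/-- The membership function generated by the nested intervals `[L α, R α]`. -/
def endpointsMem (L R : ℝ → ℝ) (x : ℝ) : ℝ :=
  sSup {α | α ∈ Icc (0 : ℝ) 1 ∧ x ∈ Icc (L α) (R α)}

lemma bddAbove_endpoints (L R : ℝ → ℝ) (x : ℝ) :
    BddAbove {α | α ∈ Icc (0 : ℝ) 1 ∧ x ∈ Icc (L α) (R α)} :=
  ⟨1, fun _ h => h.1.2⟩

lemma endpointsMem_mem_Icc (L R : ℝ → ℝ) (x : ℝ) : endpointsMem L R x ∈ Icc (0 : ℝ) 1 :=
  ⟨Real.sSup_nonneg fun _ h => h.1.1, Real.sSup_le (fun _ h => h.1.2) zero_le_one⟩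

lemma le_endpointsMem {α x : ℝ} (hα : α ∈ Icc (0 : ℝ) 1) (hx : x ∈ Icc (L α) (R α)) :
    α ≤ endpointsMem L R x :=
  le_csSup (bddAbove_endpoints L R x) ⟨hα, hx⟩

lemma mem_Icc_of_lt_endpointsMem (hL : Monotone L) (hR : Antitone R) {β x : ℝ} (hβ : 0 ≤ β)
    (h : β < endpointsMem L R x) : x ∈ Icc (L β) (R β) := by
  have hne : {α | α ∈ Icc (0 : ℝ) 1 ∧ x ∈ Icc (L α) (R α)}.Nonempty := by
    by_contra hne
    rw [endpointsMem, not_nonempty_iff_eq_empty.1 hne, Real.sSup_empty] at h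
    exact absurd hβ (not_le.2 h)
  obtain ⟨γ, hγ, hlt⟩ := exists_lt_of_lt_csSup hne h
  exact ⟨(hL hlt.le).trans hγ.2.1, hγ.2.2.trans (hR hlt.le)⟩

lemma fuzzyLevel_endpointsMem (hL : Monotone L) (hR : Antitone R) {α : ℝ}
    (hα : α ∈ Ioc (0 : ℝ) 1) :
    fuzzyLevel (endpointsMem L R) α = ⋂ β ∈ Ico (0 : ℝ) α, Icc (L β) (R β) := by
  ext x
  simp only [fuzzyLevel, hα.1.ne', if_false, mem_ofPred_eq, mem_iInter]
  refine ⟨fun h β hβ => mem_Icc_of_lt_endpointsMem hL hR hβ.1 (hβ.2.trans_le h), fun h => ?_⟩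
  refine le_of_forall_lt_imp_le_of_dense fun β hβ => ?_
  rcases le_or_gt 0 β with h0 | h0
  · exact le_endpointsMem ⟨h0, hβ.le.trans hα.2⟩ (h β ⟨h0, hβ⟩)
  · exact h0.le.trans (endpointsMem_mem_Icc L R x).1

lemma Icc_subset_fuzzyLevel_endpointsMem (hL : Monotone L) (hR : Antitone R) {α : ℝ}
    (hα : α ∈ Ioc (0 : ℝ) 1) : Icc (L α) (R α) ⊆ fuzzyLevel (endpointsMem L R) α := by
  rw [fuzzyLevel_endpointsMem hL hR hα]
  exact subset_iInter₂ fun β hβ => Icc_subset_Icc (hL hβ.2.le) (hR hβ.2.le)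

lemma fuzzyLevel_endpointsMem_zero_subset (hL : Monotone L) (hR : Antitone R) :
    fuzzyLevel (endpointsMem L R) 0 ⊆ Icc (L 0) (R 0) := by
  simp only [fuzzyLevel, if_true]
  exact closure_minimal (fun x hx => mem_Icc_of_lt_endpointsMem hL hR le_rfl hx) isClosed_Icc

/-- The fuzzy number whose levels are generated by the nested intervals `[L α, R α]`. -/
def FuzzyNumber.ofEndpoints (hL : Monotone L) (hR : Antitone R) (hLR : ∀ α, L α ≤ R α) :
    FuzzyNumber where
  mem := endpointsMem L R
  mem_range := endpointsMem_mem_Icc L R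
  level_nonempty α hα := by
    rcases hα.1.eq_or_lt with rfl | h0
    · refine ⟨L 1, ?_⟩
      simp only [fuzzyLevel, if_true]
      exact subset_closure (zero_lt_one.trans_le
        (le_endpointsMem ⟨zero_le_one, le_rfl⟩ ⟨le_rfl, hLR 1⟩))
    · exact ⟨L α, Icc_subset_fuzzyLevel_endpointsMem hL hR ⟨h0, hα.2⟩ ⟨le_rfl, hLR α⟩⟩
  level_compact α hα := by
    rcases hα.1.eq_or_lt with rfl | h0
    · refine isCompact_Icc.of_isClosed_subset ?_ (fuzzyLevel_endpointsMem_zero_subset hL hR)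
      simp only [fuzzyLevel, if_true]
      exact isClosed_closure
    · rw [fuzzyLevel_endpointsMem hL hR ⟨h0, hα.2⟩]
      exact (isCompact_Icc (a := L 0) (b := R 0)).of_isClosed_subset
        (isClosed_biInter fun _ _ => isClosed_Icc) (biInter_subset_of_mem ⟨le_rfl, h0⟩)
  level_convex α hα := by
    rcases hα.1.eq_or_lt with rfl | h0
    · simp only [fuzzyLevel, if_true]
      refine Convex.closure (OrdConnected.convex ⟨fun x hx y hy z hz => ?_⟩)
      simp only [mem_ofPred_eq] at hx hy ⊢
      obtain ⟨β, hβ0, hβ⟩ := exists_between (lt_min hx hy)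
      have h₁ := mem_Icc_of_lt_endpointsMem hL hR hβ0.le (hβ.trans_le (min_le_left _ _))
      have h₂ := mem_Icc_of_lt_endpointsMem hL hR hβ0.le (hβ.trans_le (min_le_right _ _))
      have hβ1 := (hβ.trans_le (min_le_left _ _)).le.trans (endpointsMem_mem_Icc L R x).2
      exact hβ0.trans_le (le_endpointsMem ⟨hβ0.le, hβ1⟩ ⟨h₁.1.trans hz.1, hz.2.trans h₂.2⟩)
    · rw [fuzzyLevel_endpointsMem hL hR ⟨h0, hα.2⟩]
      exact convex_iInter₂ fun _ _ => convex_Icc _ _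

lemma fuzzyLevel_ofEndpoints (hL : Monotone L) (hR : Antitone R) (hLR : ∀ α, L α ≤ R α) {α : ℝ}
    (hα : α ∈ Ioc (0 : ℝ) 1) (hcL : ContinuousAt L α) (hcR : ContinuousAt R α) :
    fuzzyLevel (FuzzyNumber.ofEndpoints hL hR hLR).mem α = Icc (L α) (R α) := by
  refine Subset.antisymm (fun x hx => ?_) (Icc_subset_fuzzyLevel_endpointsMem hL hR hα)
  change x ∈ fuzzyLevel (endpointsMem L R) α at hx
  rw [fuzzyLevel_endpointsMem hL hR hα] at hx
  have hev : ∀ᶠ β in nhdsWithin α (Iio α), x ∈ Icc (L β) (R β) := by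
    filter_upwards [Ico_mem_nhdsLT hα.1] with β hβ using mem_iInter₂.1 hx β hβ
  exact ⟨le_of_tendsto (hcL.mono_left nhdsWithin_le_nhds) (hev.mono fun _ h => h.1),
    ge_of_tendsto (hcR.mono_left nhdsWithin_le_nhds) (hev.mono fun _ h => h.2)⟩

lemma ae_suppFn_ofEndpoints (hL : Monotone L) (hR : Antitone R) (hLR : ∀ α, L α ≤ R α) :
    ∀ᵐ α : unitInterval, suppFn (FuzzyNumber.ofEndpoints hL hR hLR) 1 α = R α ∧
      suppFn (FuzzyNumber.ofEndpoints hL hR hLR) (-1) α = -L α := by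
  have hc : ({α | ¬ContinuousAt L α} ∪ {α | ¬ContinuousAt R α} ∪ {0}).Countable :=
    (hL.countable_not_continuousAt.union hR.countable_not_continuousAt).union
      (countable_singleton 0)
  have hae : ∀ᵐ α : unitInterval,
      (α : ℝ) ∉ {α | ¬ContinuousAt L α} ∪ {α | ¬ContinuousAt R α} ∪ {0} :=
    measure_eq_zero_iff_ae_notMem.1
      ((hc.preimage Subtype.val_injective).measure_zero _)
  filter_upwards [hae] with α hα
  simp only [mem_union, mem_ofPred_eq, mem_singleton_iff, not_or, not_not] at hα
  have hlev := fuzzyLevel_ofEndpoints hL hR hLR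
    ⟨α.2.1.lt_of_ne (Ne.symm hα.2), α.2.2⟩ hα.1.1 hα.1.2
  simp only [suppFn, hlev]
  constructor
  · simp [csSup_Icc (hLR α)]
  · exact IsGreatest.csSup_eq ⟨⟨L α, ⟨le_rfl, hLR α⟩, by simp⟩, by
      rintro _ ⟨x, hx, rfl⟩; simpa using hx.1⟩

end OfEndpoints

section ExpectedDistance

variable {Ω : Type*} [MeasurableSpace Ω] {P : Measure Ω}
  {𝒳 : Ω → FuzzyNumber}

lemma integrable_suppFn (hmeas : SuppMeasurable 𝒳) (hL1 : FuzzyL1 P 𝒳) {u α : ℝ}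
    (hu : u ∈ ({-1, 1} : Set ℝ)) (hα : α ∈ Icc (0 : ℝ) 1) :
    Integrable (fun ω => suppFn (𝒳 ω) u α) P :=
  hL1.mono' (hmeas u hu α hα).aestronglyMeasurable
    (.of_forall fun ω => abs_suppFn_le (𝒳 ω) hu hα)

variable [IsProbabilityMeasure P]

lemma integrable_abs_suppFn_sub_prod (hjoint : JointlyMeasurable 𝒳) (hL1 : FuzzyL1 P 𝒳)
    (A : FuzzyNumber) {u : ℝ} (hu : u ∈ ({-1, 1} : Set ℝ)) :
    Integrable (fun q : unitInterval × Ω => |suppFn A u q.1 - suppFn (𝒳 q.2) u q.1|)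
      (volume.prod P) := by
  have hX : Measurable fun q : unitInterval × Ω => suppFn (𝒳 q.2) u q.1 :=
    hjoint.comp (measurable_const.prodMk measurable_id :
      Measurable fun q : unitInterval × Ω => ((⟨u, hu⟩ : ({-1, 1} : Set ℝ)), q))
  have hA : Measurable fun q : unitInterval × Ω => suppFn A u q.1 :=
    (measurable_suppFn A u).comp measurable_fst
  have iX : Integrable (fun q : unitInterval × Ω => suppFn (𝒳 q.2) u q.1) (volume.prod P) :=
    (Integrable.comp_snd hL1 volume).mono' hX.aestronglyMeasurable
      (.of_forall fun q => abs_suppFn_le (𝒳 q.2) hu q.1.2)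
  have iA : Integrable (fun q : unitInterval × Ω => suppFn A u q.1) (volume.prod P) :=
    .of_bound hA.aestronglyMeasurable _ (.of_forall fun q => abs_suppFn_le A hu q.1.2)
  exact (iA.sub iX).abs

/-- The sum over both directions of the expected distance between the support functions. -/
def levelDist (P : Measure Ω) (𝒳 : Ω → FuzzyNumber) (A : FuzzyNumber) (α : unitInterval) : ℝ :=
  meanDist P (fun ω => suppFn (𝒳 ω) 1 α) (suppFn A 1 α) +
    meanDist P (fun ω => suppFn (𝒳 ω) (-1) α) (suppFn A (-1) α)

lemma integrable_levelDist (hjoint : JointlyMeasurable 𝒳) (hL1 : FuzzyL1 P 𝒳)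
    (A : FuzzyNumber) : Integrable (levelDist P 𝒳 A) :=
  (integrable_abs_suppFn_sub_prod hjoint hL1 A (by simp)).integral_prod_left.add
    (integrable_abs_suppFn_sub_prod hjoint hL1 A (by simp)).integral_prod_left

lemma integral_rho1_eq (hmeas : SuppMeasurable 𝒳) (hjoint : JointlyMeasurable 𝒳)
    (hL1 : FuzzyL1 P 𝒳) (A : FuzzyNumber) :
    ∫ ω, rho1 A (𝒳 ω) ∂P = (1 / 2) * ∫ α, levelDist P 𝒳 A α := by
  simp only [rho1_eq_integral]
  rw [integral_const_mul, ← integral_integral_swap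
    ((integrable_abs_suppFn_sub_prod hjoint hL1 A (u := 1) (by simp)).add
      (integrable_abs_suppFn_sub_prod hjoint hL1 A (u := -1) (by simp)))]
  congr 2 with α
  exact integral_add
    (integrable_abs_const_sub (integrable_suppFn hmeas hL1 (by simp) α.2) _)
    (integrable_abs_const_sub (integrable_suppFn hmeas hL1 (by simp) α.2) _)

lemma D1_le_D1_iff (hmeas : SuppMeasurable 𝒳) (hjoint : JointlyMeasurable 𝒳)
    (hL1 : FuzzyL1 P 𝒳) (A B : FuzzyNumber) :
    D1 P 𝒳 A ≤ D1 P 𝒳 B ↔ ∫ α, levelDist P 𝒳 B α ≤ ∫ α, levelDist P 𝒳 A α := by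
  have hpos (C : FuzzyNumber) : 0 ≤ ∫ α, levelDist P 𝒳 C α :=
    integral_nonneg fun α => add_nonneg (integral_nonneg fun _ => abs_nonneg _)
      (integral_nonneg fun _ => abs_nonneg _)
  have hA := hpos A
  have hB := hpos B
  rw [D1, D1, integral_rho1_eq hmeas hjoint hL1, integral_rho1_eq hmeas hjoint hL1,
    inv_le_inv₀ (by linarith) (by linarith)]
  constructor <;> intro h <;> linarith

/-- Some fuzzy number minimizes the expected distance at almost every level. -/
lemma exists_forall_meanDist_le (hmeas : SuppMeasurable 𝒳) (hL1 : FuzzyL1 P 𝒳) :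
    ∃ M : FuzzyNumber, ∀ᵐ α : unitInterval, ∀ u ∈ ({-1, 1} : Set ℝ), ∀ z,
      meanDist P (fun ω => suppFn (𝒳 ω) u α) (suppFn M u α) ≤
        meanDist P (fun ω => suppFn (𝒳 ω) u α) z := by
  let c : ℝ → unitInterval := projIcc 0 1 zero_le_one
  have hc : Monotone c := monotone_projIcc _
  have i₁ (α : unitInterval) : Integrable (fun ω => suppFn (𝒳 ω) 1 α) P :=
    integrable_suppFn hmeas hL1 (by simp) α.2
  have i₂ (α : unitInterval) : Integrable (fun ω => -suppFn (𝒳 ω) (-1) α) P :=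
    (integrable_suppFn hmeas hL1 (by simp) α.2).neg
  let L : ℝ → ℝ := fun α => upperMedian P fun ω => -suppFn (𝒳 ω) (-1) (c α)
  let R : ℝ → ℝ := fun α => upperMedian P fun ω => suppFn (𝒳 ω) 1 (c α)
  have hL : Monotone L := fun α β h => upperMedian_mono (i₂ _) (i₂ _) fun ω =>
    neg_le_neg (antitone_suppFn (𝒳 ω) (-1) (hc h))
  have hR : Antitone R := fun α β h => upperMedian_mono (i₁ _) (i₁ _) fun ω =>
    antitone_suppFn (𝒳 ω) 1 (hc h)
  have hLR (α : ℝ) : L α ≤ R α := upperMedian_mono (i₂ _) (i₁ _) fun ω =>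
    neg_suppFn_neg_one_le (𝒳 ω) (c α).2
  refine ⟨.ofEndpoints hL hR hLR, ?_⟩
  filter_upwards [ae_suppFn_ofEndpoints hL hR hLR] with α hα u hu z
  have hcα : c α = α := projIcc_val _ α
  rcases hu with rfl | rfl
  · rw [hα.2, ← meanDist_neg _ (-L α), ← meanDist_neg _ z, neg_neg]
    simp only [L, hcα]
    exact meanDist_upperMedian_le (i₂ α) _
  · rw [hα.1]
    simp only [R, hcα]
    exact meanDist_upperMedian_le (i₁ α) _

/-- The support function of a maximizer of `D₁` minimizes the expected distance
at almost every level. -/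
lemma ae_meanDist_le_of_isMax (hmeas : SuppMeasurable 𝒳) (hjoint : JointlyMeasurable 𝒳)
    (hL1 : FuzzyL1 P 𝒳) {A : FuzzyNumber} (hA : ∀ U : FuzzyNumber, D1 P 𝒳 U ≤ D1 P 𝒳 A) :
    ∀ᵐ α : unitInterval, ∀ u ∈ ({-1, 1} : Set ℝ), ∀ z,
      meanDist P (fun ω => suppFn (𝒳 ω) u α) (suppFn A u α) ≤
        meanDist P (fun ω => suppFn (𝒳 ω) u α) z := by
  obtain ⟨M, hM⟩ := exists_forall_meanDist_le hmeas hL1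
  have iA := integrable_levelDist hjoint hL1 A
  have iM := integrable_levelDist hjoint hL1 M
  have hle : levelDist P 𝒳 M ≤ᵐ[volume] levelDist P 𝒳 A := by
    filter_upwards [hM] with α hα
    exact add_le_add (hα 1 (by simp) _) (hα (-1) (by simp) _)
  have heq : levelDist P 𝒳 M =ᵐ[volume] levelDist P 𝒳 A :=
    (integral_eq_iff_of_ae_le iM iA hle).1 <| (integral_mono_ae iM iA hle).antisymm
      ((D1_le_D1_iff hmeas hjoint hL1 M A).1 (hA M))
  filter_upwards [hM, heq] with α hα hαeq u hu z
  have h₁ := hα 1 (by simp) (suppFn A 1 α)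
  have h₂ := hα (-1) (by simp) (suppFn A (-1) α)
  have hz := hα u hu z
  simp only [levelDist] at hαeq
  rcases hu with rfl | rfl <;> linarith

end ExpectedDistance

/-- Property P3b of `D₁` with respect to the metric `ρ₁`: if `A` maximizes `D₁(·;𝒳)`,
then for all `U, V` with `ρ₁(A,V) = ρ₁(A,U) + ρ₁(U,V)` one has
`D₁(A;𝒳) ≥ D₁(U;𝒳) ≥ D₁(V;𝒳)`. -/
theorem D1_satisfies_P3b
    {Ω : Type*} [MeasurableSpace Ω] (P : Measure Ω) [IsProbabilityMeasure P]
    (𝒳 : Ω → FuzzyNumber) (hmeas : SuppMeasurable 𝒳) (hjoint : JointlyMeasurable 𝒳)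
    (hL1 : FuzzyL1 P 𝒳) (A : FuzzyNumber)
    (hA : ∀ U : FuzzyNumber, D1 P 𝒳 U ≤ D1 P 𝒳 A) :
    ∀ U V : FuzzyNumber, rho1 A V = rho1 A U + rho1 U V →
      D1 P 𝒳 V ≤ D1 P 𝒳 U ∧ D1 P 𝒳 U ≤ D1 P 𝒳 A := by
  intro U V hUV
  refine ⟨(D1_le_D1_iff hmeas hjoint hL1 V U).2 ?_, hA U⟩
  refine integral_mono_ae (integrable_levelDist hjoint hL1 U)
    (integrable_levelDist hjoint hL1 V) ?_
  filter_upwards [ae_meanDist_le_of_isMax hmeas hjoint hL1 hA, ae_wbtw_of_rho1_eq hUV]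
    with α hmin hbtw
  have hle (u : ℝ) (hu : u ∈ ({-1, 1} : Set ℝ)) :=
    meanDist_le_of_wbtw (integrable_suppFn hmeas hL1 hu α.2) (hmin u hu) (hbtw u hu)
  exact add_le_add (hle 1 (by simp)) (hle (-1) (by simp))

end
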